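/- For every positive integer p and every integer s ≥ 2, the function h_⋆ satisfies h_⋆(p,s) ≥ h_⋆(p,2) ≥ ⌊√(p/2)⌋ + 1. -/

import Mathlib

/-- `χ^ℓ_{⋆,p}(G) ≤ s`: for every `s`-list assignment there is an `L`-coloring all of
whose monochromatic components have at most `p` vertices. -/
def starChiListLe (n : ℕ) (G : SimpleGraph (Fin n)) (p s : ℕ) : Prop :=
  ∀ L : Fin n → Finset ℕ, (∀ v, s ≤ (L v).card) →
    ∃ φ : Fin n → ℕ, (∀ v, φ v ∈ L v) ∧
      ∀ v : Fin n,
        {w : {u | φ u = φ v} |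
          (G.induce {u | φ u = φ v}).Reachable ⟨v, rfl⟩ w}.ncard ≤ p

/-- `col_{⋆,p'}(G) ≤ s'`: every nonempty induced subgraph `G[S]` contains an `s'`-island
`I` all of whose induced components have at most `p'` vertices. -/
def starColLe (n : ℕ) (G : SimpleGraph (Fin n)) (p' s' : ℕ) : Prop :=
  ∀ S : Finset (Fin n), S.Nonempty → ∃ I ⊆ S, I.Nonempty ∧
    (∀ v ∈ I, {w | G.Adj v w ∧ w ∈ S ∧ w ∉ I}.ncard < s') ∧
    ∀ v : (I : Set (Fin n)),
      {w | (G.induce (I : Set (Fin n))).Reachable v w}.ncard ≤ p'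

/-- `h_⋆(p,s)`: the smallest `s'` such that for some `p'`, every graph `G` with
`χ^ℓ_{⋆,p}(G) ≤ s` satisfies `col_{⋆,p'}(G) ≤ s'`. -/
noncomputable def hStar (p s : ℕ) : ℕ :=
  sInf {s' : ℕ | ∃ p' : ℕ, ∀ (n : ℕ) (G : SimpleGraph (Fin n)),
    starChiListLe n G p s → starColLe n G p' s'}

open Finset in
/-- If each pair `(a, φ)` is compatible with at most half of the choices `i : ι`, then fewer than
`2 ^ #A` objects `φ` can all be made incompatible by a suitable choice for each `a ∈ A`. -/
theorem exists_choice_forall_exists_not {V ι Ψ : Type*} [Fintype ι]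
    {m : ℕ} (hm : 0 < m) (hι : Fintype.card ι = 2 * m) (R : V → ι → Ψ → Prop) (A : Finset V)
    (Φ : Finset Ψ) (hR : ∀ a ∈ A, ∀ φ ∈ Φ, {i | R a i φ}.ncard ≤ m) (hΦ : #Φ < 2 ^ #A) :
    ∃ g : V → ι, ∀ φ ∈ Φ, ∃ a ∈ A, ¬ R a (g a) φ := by
  classical
  have hne : Nonempty ι := Fintype.card_pos_iff.mp (by omega)
  induction A using Finset.induction_on generalizing Φ with
  | empty =>
    have : Φ = ∅ := by simpa using hΦ
    exact ⟨fun _ => Classical.arbitrary ι, by simp [this]⟩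
  | insert a A ha ih =>
    obtain ⟨i, hi⟩ : ∃ i, 2 * #{φ ∈ Φ | R a i φ} ≤ #Φ := by
      by_contra! hcon
      have h1 : ∑ i : ι, #{φ ∈ Φ | R a i φ} = ∑ φ ∈ Φ, #{i | R a i φ} := by
        simp only [Finset.card_filter]
        exact Finset.sum_comm
      have h2 : ∑ φ ∈ Φ, #{i | R a i φ} ≤ #Φ * m := by
        refine Finset.sum_le_card_nsmul _ _ _ fun φ hφ => ?_
        have := hR a (by simp) φ hφ
        rwa [Set.ncard_eq_toFinset_card', Set.toFinset_ofPred] at this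
      have h3 : ∑ _i : ι, (#Φ + 1) ≤ ∑ i : ι, 2 * #{φ ∈ Φ | R a i φ} :=
        Finset.sum_le_sum fun i _ => hcon i
      rw [← Finset.mul_sum, h1, Finset.sum_const, Finset.card_univ, hι, smul_eq_mul] at h3
      nlinarith
    obtain ⟨g, hg⟩ := ih {φ ∈ Φ | R a i φ}
      (fun b hb φ hφ => hR b (by simp [hb]) φ (Finset.mem_of_mem_filter φ hφ))
      (by rw [Finset.card_insert_of_notMem ha, pow_succ] at hΦ; omega)
    refine ⟨Function.update g a i, fun φ hφ => ?_⟩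
    by_cases h : R a i φ
    · obtain ⟨b, hb, hbR⟩ := hg φ (by simp [hφ, h])
      refine ⟨b, by simp [hb], ?_⟩
      rwa [Function.update_of_ne (by rintro rfl; exact ha hb)]
    · exact ⟨a, by simp, by simpa using h⟩

open Finset in
/-- The proportion of functions `V → T` mapping all of `W` into `S`. -/
theorem card_filter_forall_mem {V T : Type*} [Fintype V] [DecidableEq V] [Fintype T] [DecidableEq T]
    [Nonempty T] (W : Finset V) (S : Finset T) :
    (#{f : V → T | ∀ u ∈ W, f u ∈ S} : ℝ) =
      (Fintype.card T : ℝ) ^ Fintype.card V * ((#S : ℝ) / Fintype.card T) ^ #W := by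
  have h : ({f : V → T | ∀ u ∈ W, f u ∈ S} : Finset (V → T)) =
      Fintype.piFinset fun u => if u ∈ W then S else univ := by
    ext f
    simp only [mem_filter, mem_univ, true_and, Fintype.mem_piFinset]
    refine forall_congr' fun u => ?_
    by_cases hu : u ∈ W <;> simp [hu]
  have hT : (Fintype.card T : ℝ) ≠ 0 := by exact_mod_cast Fintype.card_ne_zero
  have h2 : ∀ u, (#(if u ∈ W then S else univ) : ℝ) =
      Fintype.card T * (if u ∈ W then (#S : ℝ) / Fintype.card T else 1) := by
    intro u
    by_cases hu : u ∈ W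
    · simp only [hu, if_true]; field_simp
    · simp [hu, Finset.card_univ]
  rw [h, Fintype.card_piFinset]
  push_cast
  simp only [h2]
  rw [Finset.prod_mul_distrib, Finset.prod_const, Finset.card_univ, Finset.prod_ite,
    Finset.prod_const, Finset.prod_const_one, mul_one, Finset.filter_univ_mem]

open Finset in
/-- In a graph of large minimum degree one can label few vertices with elements of `K` such that
many vertices see all the labels in their neighborhood. -/
theorem exists_labelling_of_large_minDegree (K : Type) [Fintype K] (C : ℕ) :
    ∃ N d : ℕ, ∀ (V : Type) [Fintype V] [Nonempty V] (G : SimpleGraph V),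
      (∀ v, d ≤ {u | G.Adj v u}.ncard) → ∃ f : V → K ⊕ Fin N,
        C * {v | (f v).isLeft}.ncard < {v | ∀ x, ∃ u, G.Adj v u ∧ f u = Sum.inl x}.ncard := by
  classical
  set k := Fintype.card K with hk
  obtain ⟨N, hN⟩ : ∃ N, N = 3 * C * k + 1 := ⟨_, rfl⟩
  set t : ℝ := (k : ℝ) + N with ht
  have hk0 : (0 : ℝ) ≤ k := by positivity
  have hC0 : (0 : ℝ) ≤ C := by positivity
  have hNr : (N : ℝ) = 3 * C * k + 1 := by rw [hN]; push_cast; ring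
  have ht1 : 1 ≤ t := by
    have : 0 ≤ 3 * (C : ℝ) * k := by positivity
    linarith
  obtain ⟨d, hd⟩ : ∃ d : ℕ, ((t - 1) / t) ^ d < 1 / (3 * (k + 1)) :=
    exists_pow_lt_of_lt_one (by positivity) (by rw [div_lt_one (by linarith)]; linarith)
  refine ⟨N, d, fun V _ _ G hG => ?_⟩
  have hcardT : (Fintype.card (K ⊕ Fin N) : ℝ) = t := by simp [ht, hk]
  have : Nonempty (K ⊕ Fin N) := ⟨Sum.inr ⟨0, by omega⟩⟩
  set n := Fintype.card V with hn
  have hn0 : (0 : ℝ) < n := by exact_mod_cast Fintype.card_pos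
  by_contra! hcon
  -- the labels missed by the neighborhood of a vertex
  have hmiss : ∀ v, (#{f : V → K ⊕ Fin N | ¬ ∀ x, ∃ u, G.Adj v u ∧ f u = Sum.inl x} : ℝ) ≤
      t ^ n * (1 / 3) := by
    intro v
    have hsub : ({f : V → K ⊕ Fin N | ¬ ∀ x, ∃ u, G.Adj v u ∧ f u = Sum.inl x} : Finset _) ⊆
        univ.biUnion fun x : K =>
          {f : V → K ⊕ Fin N | ∀ u ∈ ({u | G.Adj v u} : Finset V), f u ∈ univ.erase (Sum.inl x)} := by
      intro f hf
      simp only [mem_filter, mem_univ, true_and, not_forall, not_exists, not_and] at hf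
      simpa using hf
    have h1 : (#{f : V → K ⊕ Fin N | ¬ ∀ x, ∃ u, G.Adj v u ∧ f u = Sum.inl x} : ℝ) ≤
        ∑ x : K, (#{f : V → K ⊕ Fin N |
          ∀ u ∈ ({u | G.Adj v u} : Finset V), f u ∈ univ.erase (Sum.inl x)} : ℝ) := by
      exact_mod_cast (card_le_card hsub).trans card_biUnion_le
    refine h1.trans ?_
    have h2 : ∀ x : K, (#{f : V → K ⊕ Fin N |
        ∀ u ∈ ({u | G.Adj v u} : Finset V), f u ∈ univ.erase (Sum.inl x)} : ℝ) ≤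
        t ^ n * (1 / (3 * (k + 1))) := by
      intro x
      rw [card_filter_forall_mem, hcardT]
      have hc : ((#(univ.erase (Sum.inl x : K ⊕ Fin N)) : ℕ) : ℝ) = t - 1 := by
        rw [card_erase_of_mem (mem_univ _), card_univ, Nat.cast_sub Fintype.card_pos, hcardT]
        simp
      rw [hc]
      refine mul_le_mul_of_nonneg_left ?_ (by positivity)
      refine le_trans (pow_le_pow_of_le_one (div_nonneg (by linarith) (by linarith)) ?_ ?_) hd.le
      · rw [div_le_one (by linarith)]; linarith
      · have := hG v
        rwa [Set.ncard_eq_toFinset_card', Set.toFinset_ofPred] at this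
    refine (sum_le_sum fun x _ => h2 x).trans ?_
    rw [sum_const, card_univ, nsmul_eq_mul, mul_left_comm]
    refine mul_le_mul_of_nonneg_left ?_ (by positivity)
    rw [← hk, mul_one_div, div_le_div_iff₀ (by positivity) (by positivity)]
    linarith
  have hleft : ∀ v, (#{f : V → K ⊕ Fin N | (f v).isLeft} : ℝ) = t ^ n * (k / t) := by
    intro v
    have h := card_filter_forall_mem ({v} : Finset V)
      (univ.map (Function.Embedding.inl : K ↪ K ⊕ Fin N))
    rw [hcardT, card_map, card_univ, card_singleton, pow_one] at h
    rw [← hn, ← hk] at h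
    rw [← h]
    congr 2
    ext f
    rcases h : f v with x | y <;> simp [h]
  have hsum : ∀ f : V → K ⊕ Fin N, (n : ℝ) ≤
      (#{v | ¬ ∀ x, ∃ u, G.Adj v u ∧ f u = Sum.inl x} : ℝ) + C * (#{v | (f v).isLeft} : ℝ) := by
    intro f
    have h := hcon f
    rw [Set.ncard_eq_toFinset_card', Set.ncard_eq_toFinset_card', Set.toFinset_ofPred,
      Set.toFinset_ofPred] at h
    have h' := card_filter_add_card_filter_not (s := (univ : Finset V))
      (fun v => ∀ x, ∃ u, G.Adj v u ∧ f u = Sum.inl x)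
    rw [card_univ] at h'
    have : n ≤ #{v | ¬ ∀ x, ∃ u, G.Adj v u ∧ f u = Sum.inl x} + C * #{v | (f v).isLeft} := by
      omega
    exact_mod_cast this
  have hdc : ∀ (P : (V → K ⊕ Fin N) → V → Prop) [∀ f v, Decidable (P f v)],
      ∑ f, (#{v | P f v} : ℝ) = ∑ v, (#{f | P f v} : ℝ) := by
    intro P _
    simp only [card_filter]
    push_cast
    exact sum_comm
  have htot := sum_le_sum fun f (_ : f ∈ (univ : Finset (V → K ⊕ Fin N))) => hsum f
  rw [sum_add_distrib, ← mul_sum, hdc, hdc, sum_const, card_univ, Fintype.card_fun, nsmul_eq_mul]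
    at htot
  push_cast [hleft] at htot
  have hb := sum_le_sum fun v (_ : v ∈ (univ : Finset V)) => hmiss v
  rw [sum_const, card_univ, nsmul_eq_mul, ← hn] at hb htot
  have hCk : C * (k / t) ≤ 1 / 3 := by
    rw [mul_div_assoc', div_le_div_iff₀ (by linarith) (by norm_num)]
    linarith
  have hpos : 0 < n * t ^ n := by positivity
  have hct : ((Fintype.card K : ℝ) + N) = t := by rw [ht]
  simp only [Fintype.card_sum, Fintype.card_fin, Nat.cast_add] at htot
  rw [hct] at htot
  nlinarith

open Finset in
/-- **Alon's theorem for defective list coloring**: graphs of large minimum degree have list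
assignments with lists of size `s` for which every coloring has a vertex with at least `p`
neighbors of its own color. -/
theorem exists_lists_of_large_minDegree (p s : ℕ) (hs : 1 ≤ s) :
    ∃ d : ℕ, ∀ (V : Type) [Fintype V] [Nonempty V] (G : SimpleGraph V),
      (∀ v, d ≤ {u | G.Adj v u}.ncard) → ∃ L : V → Finset ℕ, (∀ v, #(L v) = s) ∧
        ∀ φ : V → ℕ, (∀ v, φ v ∈ L v) → ∃ v, p ≤ {u | G.Adj v u ∧ φ u = φ v}.ncard := by
  classical
  let Γ := Fin (2 * s) × Fin s
  let K := {l : Finset Γ // #l = s} × Fin (s * p)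
  obtain ⟨N, d, hNd⟩ := exists_labelling_of_large_minDegree K (s + 1)
  refine ⟨d, fun V _ _ G hG => ?_⟩
  obtain ⟨f, hf⟩ := hNd V G hG
  set B : Finset V := {v | (f v).isLeft} with hB
  set A : Finset V := {v | (∀ x, ∃ u, G.Adj v u ∧ f u = Sum.inl x) ∧ v ∉ B} with hA
  have hAB : s * #B < #A := by
    rw [Set.ncard_eq_toFinset_card', Set.ncard_eq_toFinset_card', Set.toFinset_ofPred,
      Set.toFinset_ofPred, ← hB] at hf
    have : ({v | ∀ x, ∃ u, G.Adj v u ∧ f u = Sum.inl x} : Finset V) ⊆ A ∪ B := by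
      intro v hv
      by_cases hvB : v ∈ B
      · simp [hvB]
      · simp only [mem_filter, mem_univ, true_and] at hv
        simp only [mem_union, hA, mem_filter, mem_univ, true_and]
        exact Or.inl ⟨hv, hvB⟩
    have := (card_le_card this).trans (card_union_le _ _)
    nlinarith
  let c₀ : Γ := (⟨0, by omega⟩, ⟨0, by omega⟩)
  let M : V → Finset Γ := fun v => Sum.elim (fun x : K => x.1.1) (fun _ => {c₀}) (f v)
  let Φ : Finset (V → Γ) := Fintype.piFinset M
  let F : V → (V → Γ) → Γ → Finset V := fun a φ c => {u | G.Adj a u ∧ u ∈ B ∧ φ u = c}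
  have hMB : ∀ v, #(M v) = if v ∈ B then s else 1 := by
    intro v
    rcases h : f v with x | y
    · simp [M, h, hB, x.1.2]
    · simp [M, h, hB]
  have hΦ : #Φ < 2 ^ #A := by
    have h1 : #Φ = s ^ #B := by
      simp only [Φ, Fintype.card_piFinset, hMB]
      rw [prod_ite]
      simp
    rw [h1]
    calc s ^ #B ≤ (2 ^ s) ^ #B := Nat.pow_le_pow_left Nat.lt_two_pow_self.le _
      _ = 2 ^ (s * #B) := (pow_mul _ _ _).symm
      _ < 2 ^ #A := Nat.pow_lt_pow_right (by norm_num) hAB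
  have hrare : ∀ a ∈ A, ∀ φ ∈ Φ, #{c | #(F a φ c) < p} < s := by
    intro a ha φ hφ
    by_contra! hcon
    obtain ⟨l, hl, hls⟩ := exists_subset_card_eq hcon
    simp only [hA, mem_filter, mem_univ, true_and] at ha
    choose u hu using fun r : Fin (s * p) => ha.1 (⟨l, hls⟩, r)
    have hinj : Function.Injective u := by
      intro r r' h
      have h1 := (hu r).2
      rw [h, (hu r').2] at h1
      exact (Prod.mk.inj (Sum.inl.inj h1)).2.symm
    have hsub : univ.map ⟨u, hinj⟩ ⊆ l.biUnion (F a φ) := by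
      intro w hw
      simp only [mem_map, mem_univ, true_and, Function.Embedding.coeFn_mk] at hw
      obtain ⟨r, rfl⟩ := hw
      have hmem := Fintype.mem_piFinset.mp hφ (u r)
      simp only [M, (hu r).2, Sum.elim_inl] at hmem
      simp only [mem_biUnion, F, mem_filter, mem_univ, true_and]
      exact ⟨φ (u r), hmem, (hu r).1, by simp [hB, (hu r).2], rfl⟩
    have h1 := (card_le_card hsub).trans card_biUnion_le
    rw [card_map, card_univ, Fintype.card_fin] at h1
    have h2 : ∑ c ∈ l, #(F a φ c) < ∑ _c ∈ l, p := by
      refine sum_lt_sum_of_nonempty (card_pos.mp (by omega)) fun c hc => ?_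
      have := hl hc
      simpa using this
    rw [sum_const, hls, smul_eq_mul] at h2
    omega
  obtain ⟨g, hg⟩ := exists_choice_forall_exists_not (ι := Fin (2 * s)) (m := s) hs (by simp)
    (fun a i φ => ∃ j, #(F a φ (i, j)) < p) A Φ (by
      intro a ha φ hφ
      rw [Set.ncard_eq_toFinset_card', Set.toFinset_ofPred]
      refine le_trans (card_le_card (t := ({c | #(F a φ c) < p} : Finset Γ).image Prod.fst) ?_)
        (card_image_le.trans (hrare a ha φ hφ).le)
      intro i hi
      simp only [mem_filter, mem_univ, true_and] at hi
      obtain ⟨j, hj⟩ := hi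
      exact mem_image.mpr ⟨(i, j), by simpa using hj, rfl⟩) hΦ
  let e : Γ ↪ ℕ := (Fintype.equivFin Γ).toEmbedding.trans Fin.valEmbedding
  let L : V → Finset Γ := fun v => if v ∈ B then M v else {g v} ×ˢ univ
  refine ⟨fun v => (L v).map e, fun v => ?_, fun φ hφ => ?_⟩
  · by_cases hv : v ∈ B
    · simp [L, hv, hMB]
    · simp [L, hv]
  · choose ψ hψ hψe using fun v => mem_map.mp (hφ v)
    let ψ' : V → Γ := fun v => if v ∈ B then ψ v else c₀
    have hψ' : ψ' ∈ Φ := by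
      refine Fintype.mem_piFinset.mpr fun v => ?_
      by_cases hv : v ∈ B
      · have := hψ v
        simp only [L, if_pos hv] at this
        simpa only [ψ', if_pos hv] using this
      · rcases h : f v with x | y
        · exact absurd (by simp [hB, h]) hv
        · simp [M, h, ψ', hv]
    obtain ⟨a, ha, hag⟩ := hg ψ' hψ'
    have haB : a ∉ B := by
      simp only [hA, mem_filter] at ha
      exact ha.2.2
    push Not at hag
    have hψa := hψ a
    simp only [L, if_neg haB] at hψa
    replace hψa := mem_singleton.mp (mem_product.mp hψa).1
    refine ⟨a, (hag (ψ a).2).trans ?_⟩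
    rw [Set.ncard_eq_toFinset_card', Set.toFinset_ofPred]
    refine card_le_card fun u hu => ?_
    simp only [F, mem_filter, mem_univ, true_and] at hu ⊢
    refine ⟨hu.1, ?_⟩
    have h1 : ψ u = ψ a := by
      have := hu.2.2
      simp only [ψ', if_pos hu.2.1] at this
      rw [this, ← hψa]
    rw [← hψe u, ← hψe a, h1]

/-- For every `p` and `s`, the clustered coloring number of a graph is bounded in terms of its
clustered list chromatic number. -/
theorem exists_starColLe_of_starChiListLe (p s : ℕ) (hs : 1 ≤ s) :
    ∃ s' p' : ℕ, ∀ (n : ℕ) (G : SimpleGraph (Fin n)), starChiListLe n G p s → starColLe n G p' s' := by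
  classical
  obtain ⟨d, hd⟩ := exists_lists_of_large_minDegree p s hs
  refine ⟨d, 1, fun n G hG S hS => ?_⟩
  obtain ⟨v, hvS, hv⟩ : ∃ v ∈ S, {w | G.Adj v w ∧ w ∈ S}.ncard < d := by
    by_contra! hcon
    have : Nonempty S := hS.to_subtype
    obtain ⟨L, hL, hφ⟩ := hd S (G.induce (S : Set (Fin n))) (by
      rintro ⟨v, hv⟩
      refine (hcon v hv).trans ?_
      rw [← Set.ncard_image_of_injective _ Subtype.val_injective]
      refine Set.ncard_le_ncard ?_
      rintro w ⟨hw, hwS⟩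
      exact ⟨⟨w, hwS⟩, hw, rfl⟩)
    obtain ⟨φ, hφL, hφc⟩ := hG (fun v => if h : v ∈ S then L ⟨v, h⟩ else Finset.range s) (by
      intro v
      by_cases h : v ∈ S <;> simp [h, hL])
    obtain ⟨v, hv⟩ := hφ (fun v => φ v) (by
      rintro ⟨v, hv⟩
      simpa [hv] using hφL v)
    have h1 := hφc v
    have h2 : insert v.1 (Subtype.val '' {u : S | (G.induce (S : Set (Fin n))).Adj v u ∧
        φ u = φ v}) ⊆ Subtype.val '' {w : {u | φ u = φ v} |
          (G.induce {u | φ u = φ v}).Reachable ⟨v, rfl⟩ w} := by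
      rintro w (rfl | ⟨u, ⟨hu, huv⟩, rfl⟩)
      · exact ⟨⟨v, rfl⟩, SimpleGraph.Reachable.refl _, rfl⟩
      · exact ⟨⟨u, huv⟩, SimpleGraph.Adj.reachable (by simpa using hu), rfl⟩
    have h3 := Set.ncard_le_ncard h2
    rw [Set.ncard_insert_of_notMem (by
      rintro ⟨u, ⟨hu, -⟩, huv⟩
      rw [SimpleGraph.comap_adj] at hu
      exact hu.ne huv.symm), Set.ncard_image_of_injective _ Subtype.val_injective,
      Set.ncard_image_of_injective _ Subtype.val_injective] at h3
    omega
  refine ⟨{v}, by simpa using hvS, by simp, ?_, ?_⟩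
  · intro w hw
    rw [Finset.mem_singleton] at hw
    subst hw
    refine lt_of_le_of_lt (Set.ncard_le_ncard ?_) hv
    exact fun x hx => ⟨hx.1, hx.2.1⟩
  · intro w
    refine (Set.ncard_le_ncard (Set.subset_univ _)).trans ?_
    rw [Set.ncard_univ]
    simp

/-- The `t`-th power of the path on `n` vertices. -/
def pathPower (n t : ℕ) : SimpleGraph (Fin n) where
  Adj u v := u ≠ v ∧ u.1 ≤ v.1 + t ∧ v.1 ≤ u.1 + t
  symm := ⟨fun _ _ h => ⟨h.1.symm, h.2.2, h.2.1⟩⟩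
  loopless := ⟨fun _ h => h.1 rfl⟩

/-- A property preserved along edges is preserved along walks. -/
theorem SimpleGraph.Reachable.preserves {V : Type*} {G : SimpleGraph V} {P : V → Prop}
    (hP : ∀ a b, G.Adj a b → P a → P b) {a b : V} (h : G.Reachable a b) (ha : P a) : P b := by
  obtain ⟨w⟩ := h
  induction w with
  | nil => exact ha
  | cons h _ ih => exact ih (hP _ _ h ha)

/-- Given lists of size at least two, one can choose colors such that every vertex avoids the
color of one prescribed smaller vertex. -/
theorem exists_color_ne_parent (L : ℕ → Finset ℕ) (hL : ∀ v, 2 ≤ (L v).card) (par : ℕ → ℕ) :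
    ∃ φ : ℕ → ℕ, ∀ v, φ v ∈ L v ∧ (par v < v → φ v ≠ φ (par v)) := by
  choose pick hpick using fun v c => Finset.exists_mem_ne (hL v) c
  let φ : ℕ → ℕ := WellFounded.fix Nat.lt_wfRel.wf
    fun v ih => pick v (if h : par v < v then ih (par v) h else 0)
  have hφ : ∀ v, φ v = pick v (if par v < v then φ (par v) else 0) := by
    intro v
    simp only [φ]
    rw [WellFounded.fix_eq]
    by_cases h : par v < v <;> simp [h]
  refine ⟨φ, fun v => ⟨?_, fun h => ?_⟩⟩
  · rw [hφ]; exact (hpick _ _).1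
  · rw [hφ v, if_pos h]; exact (hpick _ _).2

/-- A connected induced subgraph of `pathPower n t` meets every interval of `t` vertices which it
does not lie to one side of. -/
theorem exists_reachable_mem_interval {n t : ℕ} {X : Set (Fin n)} {u w : X}
    (h : ((pathPower n t).induce X).Reachable u w) (a : ℕ) (hu : u.1.1 < a + t) (hw : a ≤ w.1.1) :
    ∃ x : X, a ≤ x.1.1 ∧ x.1.1 < a + t := by
  by_contra! hcon
  have hua : u.1.1 < a := by
    by_contra! h
    exact absurd (hcon u h) (by omega)
  have := h.preserves (P := fun x => x.1.1 < a) (fun x y hxy hx => by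
    obtain ⟨-, -, h2⟩ := hxy
    by_contra! h
    have := hcon y h
    simp only [Function.Embedding.subtype_apply] at h2
    omega) hua
  omega

/-- Path powers satisfy `χ^ℓ_{⋆,p}(P_n^t) ≤ 2` as soon as `p ≥ max 1 (2t²)`. -/
theorem starChiListLe_pathPower (n t p : ℕ) (hp : 1 ≤ p) (htp : 2 * (t * t) ≤ p) :
    starChiListLe n (pathPower n t) p 2 := by
  intro L hL
  obtain ⟨φ, hφ⟩ := exists_color_ne_parent (fun i => if h : i < n then L ⟨i, h⟩ else {0, 1})
    (fun i => by
      by_cases h : i < n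
      · simpa [h] using hL _
      · simp [h])
    (fun y => (y / (t * t)) * (t * t) - t + (y % (t * t)) / t)
  refine ⟨fun v => φ v, fun v => by simpa using (hφ v).1, fun v => ?_⟩
  set X : Set (Fin n) := {u | φ u = φ v} with hX
  set H := (pathPower n t).induce X
  rcases Nat.eq_zero_or_pos t with rfl | ht
  · refine le_trans ?_ hp
    refine (Set.ncard_le_ncard (t := {⟨v, rfl⟩}) ?_).trans (Set.ncard_singleton _).le
    intro w hw
    refine SimpleGraph.Reachable.preserves (P := fun x => x = ⟨v, rfl⟩) ?_ hw rfl
    rintro a b ⟨h1, h2, h3⟩ -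
    simp only [add_zero] at h2 h3
    exact absurd (Fin.ext (le_antisymm h2 h3)) h1
  have htt : 0 < t * t := Nat.mul_pos ht ht
  have key : ∀ u w : X, H.Reachable u w → w.1.1 / (t * t) ≤ u.1.1 / (t * t) + 1 := by
    intro u w huw
    by_contra! hlt
    set k := u.1.1 / (t * t) with hk
    have hu : u.1.1 < (k + 1) * (t * t) := by
      rw [← Nat.div_lt_iff_lt_mul htt]; omega
    have hw : (k + 2) * (t * t) ≤ w.1.1 := by
      rw [← Nat.le_div_iff_mul_le htt]; omega
    have hle : t ≤ (k + 1) * (t * t) := by nlinarith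
    obtain ⟨x, hx1, hx2⟩ := exists_reachable_mem_interval huw ((k + 1) * (t * t) - t)
      (by omega) (by nlinarith [Nat.sub_le ((k + 1) * (t * t)) t])
    obtain ⟨j, hj⟩ : ∃ j, x.1.1 = (k + 1) * (t * t) - t + j := ⟨_, (Nat.add_sub_of_le hx1).symm⟩
    have hjt : j < t := by omega
    have hjt' : j * t + t ≤ t * t := by nlinarith
    obtain ⟨y, hy1, hy2⟩ := exists_reachable_mem_interval huw ((k + 1) * (t * t) + j * t)
      (by omega) (by nlinarith)
    obtain ⟨r, hr⟩ : ∃ r, y.1.1 = (k + 1) * (t * t) + (j * t + r) :=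
      ⟨y.1.1 - ((k + 1) * (t * t) + j * t), by omega⟩
    have hq : y.1.1 / (t * t) = k + 1 := by
      rw [hr, mul_comm (k + 1), Nat.mul_add_div htt, Nat.div_eq_of_lt (by omega), add_zero]
    have hm : y.1.1 % (t * t) / t = j := by
      rw [hr, Nat.mul_add_mod', Nat.mod_eq_of_lt (by omega), mul_comm j t, Nat.mul_add_div ht,
        Nat.div_eq_of_lt (by omega)]
      rfl
    have := (hφ y.1.1).2
    simp only [hq, hm] at this
    rw [← hj] at this
    exact this (by omega) (y.2.trans x.2.symm)
  obtain ⟨m, hm, hmin⟩ := Set.exists_min_image {w : X | H.Reachable ⟨v, rfl⟩ w}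
    (fun w => w.1.1 / (t * t)) (Set.toFinite _) ⟨⟨v, rfl⟩, SimpleGraph.Reachable.refl _⟩
  set k := m.1.1 / (t * t)
  refine le_trans ?_ htp
  rw [← Set.ncard_image_of_injective _
    (Fin.val_injective.comp (Subtype.val_injective (p := fun x => x ∈ X)))]
  refine (Set.ncard_le_ncard (t := (Finset.Ico (k * (t * t)) ((k + 2) * (t * t)) : Finset ℕ))
    ?_ (Finset.finite_toSet _)).trans ?_
  · rintro _ ⟨w, hw, rfl⟩
    have h1 := hmin w hw
    have h2 := key m w (hm.symm.trans hw)
    simp only [Finset.coe_Ico, Set.mem_Ico, Function.comp_apply]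
    rw [← Nat.le_div_iff_mul_le htt, ← Nat.div_lt_iff_lt_mul htt]
    exact ⟨h1, by omega⟩
  · rw [Set.ncard_coe_finset, Nat.card_Ico, ← Nat.sub_mul]
    simp

/-- Long path powers satisfy `col_{⋆,p'}(P_n^t) ≥ t + 1`. -/
theorem not_starColLe_pathPower {t s' : ℕ} (p' : ℕ) (hs' : s' ≤ t) :
    ¬ starColLe (t * (p' + 2) + 1) (pathPower (t * (p' + 2) + 1) t) p' s' := by
  intro hcol
  set n := t * (p' + 2) + 1 with hn
  obtain ⟨I, -, hI, hout, hcomp⟩ := hcol Finset.univ ⟨⟨0, by omega⟩, by simp⟩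
  -- a vertex of the island cannot have an interval of `t` neighbors outside it
  have hint : ∀ v ∈ I, ∀ a : ℕ, a + t ≤ n → a ≤ v.1 + 1 → v.1 ≤ a + t →
      ∃ w ∈ I, a ≤ w.1 ∧ w.1 < a + t := by
    intro v hv a han hav hva
    by_contra! hcon
    refine absurd (hout v hv) (not_lt.mpr (hs'.trans ?_))
    let e : Fin t → Fin n := fun i => ⟨a + i, by omega⟩
    have he : Function.Injective e := fun i j hij => by
      simp only [e, Fin.mk.injEq] at hij
      omega
    have heI : ∀ i, e i ∉ I := fun i hi => by
      have := hcon (e i) hi (by simp [e])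
      simp [e] at this
      omega
    calc t = (Set.range e).ncard := by
          rw [← Set.image_univ, Set.ncard_image_of_injective _ he, Set.ncard_univ]; simp
      _ ≤ _ := by
          refine Set.ncard_le_ncard ?_
          rintro _ ⟨i, rfl⟩
          refine ⟨⟨?_, ?_, ?_⟩, Finset.mem_univ _, heI i⟩
          · exact fun h => heI i (h ▸ hv)
          · simp only [e]; omega
          · simp only [e]; omega
  obtain ⟨m, hm, hmin⟩ := I.exists_min_image (fun v => v.1) hI
  have hmt : m.1 < t := by
    by_contra! h
    obtain ⟨w, hw, h1, h2⟩ := hint m hm (m.1 - t) (by omega) (by omega) (by omega)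
    have := hmin w hw
    omega
  let H := (pathPower n t).induce (I : Set (Fin n))
  have hchain : ∀ i : ℕ, i ≤ p' → ∃ (a : (I : Set (Fin n))) (C : Finset (I : Set (Fin n))),
      H.Reachable ⟨m, hm⟩ a ∧ a.1.1 < t * (i + 1) ∧ C.card = i + 1 ∧
        ∀ c ∈ C, H.Reachable ⟨m, hm⟩ c ∧ c.1.1 ≤ a.1.1 := by
    classical
    intro i
    induction i with
    | zero =>
      intro _
      exact ⟨⟨m, hm⟩, {⟨m, hm⟩}, .refl _, by simpa using hmt, by simp, by simp⟩
    | succ i ih =>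
      intro hi
      obtain ⟨a, C, ha, hat, hC, hCa⟩ := ih (by omega)
      have hle : t * (i + 1) + t ≤ t * (p' + 2) := by nlinarith
      obtain ⟨w, hw, h1, h2⟩ := hint a.1 a.2 (a.1.1 + 1) (by omega) (by omega) (by omega)
      have haw : H.Reachable ⟨m, hm⟩ ⟨w, hw⟩ := by
        refine ha.trans (SimpleGraph.Adj.reachable ⟨?_, ?_, ?_⟩)
        · intro h
          have := congrArg Fin.val h
          simp at this
          omega
        · simp; omega
        · simp; omega
      refine ⟨⟨w, hw⟩, insert ⟨w, hw⟩ C, haw, ?_, ?_, ?_⟩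
      · simp only; nlinarith
      · rw [Finset.card_insert_of_notMem, hC]
        intro h
        have := (hCa _ h).2
        simp only at this
        omega
      · intro c hc
        rcases Finset.mem_insert.mp hc with rfl | hc
        · exact ⟨haw, le_rfl⟩
        · exact ⟨(hCa c hc).1, by have := (hCa c hc).2; simp only; omega⟩
  obtain ⟨a, C, -, -, hC, hCa⟩ := hchain p' le_rfl
  have h1 : (C : Set (I : Set (Fin n))).ncard ≤ _ :=
    Set.ncard_le_ncard (t := {w | H.Reachable ⟨m, hm⟩ w}) (fun c hc => (hCa c hc).1)
  rw [Set.ncard_coe_finset, hC] at h1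
  have h2 : _ ≤ p' := h1.trans (hcomp ⟨m, hm⟩)
  omega

/-- The condition `χ^ℓ_{⋆,p}(G) ≤ s` is monotone in `s`. -/
theorem starChiListLe.mono {n p s₁ s₂ : ℕ} {G : SimpleGraph (Fin n)} (h : starChiListLe n G p s₁)
    (hs : s₁ ≤ s₂) : starChiListLe n G p s₂ :=
  fun L hL => h L fun v => hs.trans (hL v)

/-- for every positive `p` and every `s ≥ 2`,
`h_⋆(p,s) ≥ h_⋆(p,2) ≥ ⌊√(p/2)⌋ + 1`. -/
theorem stmt_15 (p s : ℕ) (hp : 1 ≤ p) (hs : 2 ≤ s) :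
    Nat.sqrt (p / 2) + 1 ≤ hStar p 2 ∧ hStar p 2 ≤ hStar p s := by
  constructor
  · refine le_csInf (exists_starColLe_of_starChiListLe p 2 (by norm_num)) ?_
    rintro s' ⟨p', h⟩
    by_contra! hlt
    have hsq := Nat.sqrt_le (p / 2)
    exact not_starColLe_pathPower p' (Nat.lt_succ_iff.mp hlt)
      (h _ _ (starChiListLe_pathPower _ _ p hp (by omega)))
  · refine csInf_le_csInf (OrderBot.bddBelow _)
      (exists_starColLe_of_starChiListLe p s (by omega)) ?_
    rintro s' ⟨p', h⟩
    exact ⟨p', fun n G hG => h n G (hG.mono hs)⟩
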